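/- arXiv:1511.00176 — 2 statements merged into one kernel-verified Lean document; each statement's English description precedes it below -/
import Mathlib

section
/- Define F^HN_β(N) := the ℂ[z,z⁻¹]-span of V_β ∩ M. Then for every γ ∈ ℝ and every p ∈ ℤ one has (F^HN_{γ+p}(N) ∩ V_γ) + V_{<γ} = (V_γ ∩ z^{−p}·M) + V_{<γ}, where z^{−p}·M denotes the image of M under multiplication by z^{−p} in N; equivalently, the filtration induced by F^HN_{γ+•} on gr^V_γ N := V_γ/V_{<γ} coincides with the filtration induced by the lattices z^{−p}·M. (Lemma 3.2.6, second part, of 'Irregular Hodge theory'.) -/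
noncomputable section

open Submodule Set

variable {N : Type*} [AddCommGroup N] [Module ℂ N]

/-- `M` is (the image of) a finite free `ℂ[z]`-module of rank `r` inside
`N = ℂ[z,z⁻¹] ⊗_{ℂ[z]} M`, where multiplication by `z` is the automorphism `z` of `N`.
This is encoded by `z`-stability of `M` together with the existence of an `r`-element
family `b` of elements of `M` such that `(z^k (b i))` for `k ∈ ℤ` is a `ℂ`-basis of `N`
and `(z^k (b i))` for `k ∈ ℕ` is a `ℂ`-basis of `M`. -/
def IsFreeLattice (z : N ≃ₗ[ℂ] N) (M : Submodule ℂ N) (r : ℕ) : Prop :=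
  (∀ x ∈ M, z x ∈ M) ∧
  ∃ b : Fin r → N,
    LinearIndependent ℂ (fun p : Fin r × ℤ => (z ^ p.2) (b p.1)) ∧
    Submodule.span ℂ (Set.range fun p : Fin r × ℤ => (z ^ p.2) (b p.1)) = ⊤ ∧
    Submodule.span ℂ (Set.range fun p : Fin r × ℕ => (z ^ (p.2 : ℤ)) (b p.1)) = M

/-- A V-lattice filtration on `N` (with jumps in `A + ℤ`, `A ⊆ [0,1)` finite):
(i) increasing; (ii) `z · V_β = V_{β+1}`; (iii) each `V_β` is stable under `z⁻¹` and
finitely generated over `ℂ[z⁻¹]`; (iv) the `ℂ[z,z⁻¹]`-span of each `V_β` is `N`;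
(v) `V_β = V_γ` if `(β,γ] ∩ (A + ℤ) = ∅`. -/
structure IsVLattice (z : N ≃ₗ[ℂ] N) (V : ℝ → Submodule ℂ N) (A : Finset ℝ) : Prop where
  mono : Monotone V
  map_z : ∀ β : ℝ, (V β).map z.toLinearMap = V (β + 1)
  zinv_stable : ∀ β : ℝ, ∀ x ∈ V β, z.symm x ∈ V β
  fg_zinv : ∀ β : ℝ, ∃ S : Finset N, (S : Set N) ⊆ (V β : Set N) ∧
    V β = Submodule.span ℂ {x : N | ∃ k : ℕ, ∃ s ∈ S, x = (z.symm ^ k) s}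
  span_laurent : ∀ β : ℝ, Submodule.span ℂ {x : N | ∃ k : ℤ, ∃ v ∈ V β, x = (z ^ k) v} = ⊤
  jumpsIn : ∀ a ∈ A, (0 : ℝ) ≤ a ∧ a < 1
  jumps : ∀ β γ : ℝ, β ≤ γ →
    (∀ a ∈ A, ∀ k : ℤ, ¬ (β < a + k ∧ a + k ≤ γ)) → V β = V γ

/-- `V_{<β} := ⋃_{γ < β} V_γ`. -/
def Vlt (V : ℝ → Submodule ℂ N) (β : ℝ) : Submodule ℂ N := ⨆ γ ∈ Set.Iio β, V γ

/-- The Harder–Narasimhan filtration of `N`: `F^HN_β(N)` is the `ℂ[z,z⁻¹]`-span of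
`V_β ∩ M`. -/
def FHN (z : N ≃ₗ[ℂ] N) (V : ℝ → Submodule ℂ N) (M : Submodule ℂ N) (β : ℝ) :
    Submodule ℂ N :=
  Submodule.span ℂ {x : N | ∃ k : ℤ, ∃ v ∈ V β ⊓ M, x = (z ^ k) v}


theorem IsVLattice.zpow_mem {z : N ≃ₗ[ℂ] N} {V : ℝ → Submodule ℂ N} {A : Finset ℝ}
    (hV : IsVLattice z V A) (k : ℤ) {β : ℝ} {x : N} (hx : x ∈ V β) :
    (z ^ k) x ∈ V (β + k) := by
  induction k with
  | zero => simpa using hx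
  | succ n ih =>
    have h : z ((z ^ (n : ℤ)) x) ∈ V (β + (n : ℤ) + 1) := by
      rw [← hV.map_z]
      exact Submodule.mem_map_of_mem (f := z.toLinearMap) ih
    rw [add_comm (n : ℤ) 1, zpow_one_add, LinearEquiv.mul_apply]
    convert h using 2
    push_cast
    ring
  | pred n ih =>
    have h : (z ^ (-(n : ℤ))) x ∈ (V (β + (-(n : ℤ) - 1 : ℤ))).map z.toLinearMap := by
      rw [hV.map_z]
      convert ih using 2
      push_cast
      ring
    obtain ⟨y, hy, hyx⟩ := h
    have hz : (z ^ (-(n : ℤ) - 1)) x = y := by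
      rw [sub_eq_neg_add, zpow_add, zpow_neg_one, LinearEquiv.mul_apply, ← hyx]
      exact z.symm_apply_apply y
    rwa [hz]

theorem zpow_mem_of_nonneg {z : N ≃ₗ[ℂ] N} {M : Submodule ℂ N} (hM : ∀ x ∈ M, z x ∈ M)
    {k : ℤ} (hk : 0 ≤ k) {x : N} (hx : x ∈ M) : (z ^ k) x ∈ M := by
  lift k to ℕ using hk
  induction k with
  | zero => simpa using hx
  | succ n ih =>
    rw [Nat.cast_succ, add_comm (n : ℤ) 1, zpow_one_add]
    exact hM _ ih

theorem IsVLattice.FHN_le {z : N ≃ₗ[ℂ] N} {V : ℝ → Submodule ℂ N} {A : Finset ℝ}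
    (hV : IsVLattice z V A) {M : Submodule ℂ N} (hM : ∀ x ∈ M, z x ∈ M) (γ : ℝ) (p : ℤ) :
    FHN z V M (γ + p) ≤ M.map ((z ^ (-p)).toLinearMap) ⊔ V (γ - 1) := by
  refine Submodule.span_le.mpr ?_
  rintro _ ⟨k, w, ⟨hwV, hwM⟩, rfl⟩
  rcases le_or_gt 0 (k + p) with hk | hk
  · refine Submodule.mem_sup_left ⟨(z ^ (k + p)) w, zpow_mem_of_nonneg hM hk hwM, ?_⟩
    change (z ^ (-p)) ((z ^ (k + p)) w) = (z ^ k) w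
    rw [← LinearEquiv.mul_apply, ← zpow_add]
    congr 2
    ring
  · refine Submodule.mem_sup_right (hV.mono ?_ (hV.zpow_mem k hwV))
    have : (k : ℝ) + p ≤ -1 := by exact_mod_cast (by lia : k + p ≤ -1)
    linarith

theorem IsVLattice.inf_map_le_FHN {z : N ≃ₗ[ℂ] N} {V : ℝ → Submodule ℂ N} {A : Finset ℝ}
    (hV : IsVLattice z V A) (M : Submodule ℂ N) (γ : ℝ) (p : ℤ) :
    V γ ⊓ M.map ((z ^ (-p)).toLinearMap) ≤ FHN z V M (γ + p) := by
  rintro _ ⟨hxV, m, hm, rfl⟩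
  refine Submodule.subset_span ⟨-p, m, ⟨?_, hm⟩, rfl⟩
  have h := hV.zpow_mem p hxV
  change (z ^ p) ((z ^ (-p)) m) ∈ V (γ + p) at h
  rwa [← LinearEquiv.mul_apply, ← zpow_add, add_neg_cancel, zpow_zero] at h

/-- Lemma 3.2.6, second part: for every `γ ∈ ℝ` and `p ∈ ℤ`,
`(F^HN_{γ+p}(N) ∩ V_γ) + V_{<γ} = (V_γ ∩ z^{-p}·M) + V_{<γ}`. -/
theorem statement1 (z : N ≃ₗ[ℂ] N) (M : Submodule ℂ N) (r : ℕ)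
    (V : ℝ → Submodule ℂ N) (A : Finset ℝ)
    (hM : IsFreeLattice z M r) (hV : IsVLattice z V A) :
    ∀ (γ : ℝ) (p : ℤ),
      (FHN z V M (γ + p) ⊓ V γ) ⊔ Vlt V γ =
        (V γ ⊓ M.map ((z ^ (-p)).toLinearMap)) ⊔ Vlt V γ := by
  intro γ p
  have hlt : V (γ - 1) ≤ Vlt V γ := le_iSup₂_of_le (γ - 1) (sub_one_lt γ) le_rfl
  refine le_antisymm (sup_le ?_ le_sup_right)
    (sup_le_sup_right (le_inf (hV.inf_map_le_FHN M γ p) inf_le_left) _)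
  rintro x ⟨hxF, hxV⟩
  obtain ⟨m, hm, v, hv, rfl⟩ := Submodule.mem_sup.mp (hV.FHN_le hM.1 γ p hxF)
  have hvγ : v ∈ V γ := hV.mono (sub_one_lt γ).le hv
  exact Submodule.add_mem_sup ⟨(Submodule.add_mem_iff_left _ hvγ).mp hxV, hm⟩ (hlt hv)
end
end

section
/- Suppose E₁ ⊆ M₁ and E₂ ⊆ M₂ are V-adapted trivializing subspaces, and let E ⊆ M denote the image of E₁ ⊗_ℂ E₂ in M = M₁ ⊗_{ℂ[z]} M₂. Let U_γ := Σ_{γ₁+γ₂=γ} (ℂ-span of {x₁⊗x₂ : x₁ ∈ V¹_{γ₁}, x₂ ∈ V²_{γ₂}}) be the convolution filtration on N. Then E is a V-adapted trivializing subspace for (M, (U_γ)): M = ⊕_{j≥0} z^j·E and U_γ ∩ M = ⊕_{j≥0} z^j·(U_{γ−j} ∩ E) for every γ ∈ ℝ; moreover U_γ ∩ E = Σ_{γ₁+γ₂=γ} (image in E of (V¹_{γ₁} ∩ E₁) ⊗_ℂ (V²_{γ₂} ∩ E₂)). (Proposition 3.2.13 of 'Irregular Hodge theory'.) -/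
noncomputable section

open Submodule Set LaurentPolynomial

open scoped TensorProduct

/-- The ring `ℂ[z,z⁻¹]` of Laurent polynomials. -/
abbrev L : Type := LaurentPolynomial ℂ

variable {N : Type*} [AddCommGroup N] [Module ℂ N]

/-- Multiplication by `z` (the Laurent variable `T 1`) as a `ℂ`-linear automorphism of a
`ℂ[z,z⁻¹]`-module. -/
def zmul (N : Type*) [AddCommGroup N] [Module L N] [Module ℂ N] [IsScalarTower ℂ L N] :
    N ≃ₗ[ℂ] N where
  toFun x := (T 1 : L) • x
  invFun x := (T (-1) : L) • x
  map_add' x y := smul_add _ x y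
  map_smul' c x := smul_comm (T 1 : L) c x
  left_inv x := by show (T (-1) : L) • (T 1 : L) • x = x; rw [smul_smul, ← T_add]; simp
  right_inv x := by show (T 1 : L) • (T (-1) : L) • x = x; rw [smul_smul, ← T_add]; simp

/-- `T` is the internal direct sum of the family of subspaces `W`. -/
def IsInternalDirectSum {P : Type*} [AddCommGroup P] [Module ℂ P] {ι : Type*}
    (W : ι → Submodule ℂ P) (T : Submodule ℂ P) : Prop :=
  iSup W = T ∧ ∀ i : ι, W i ⊓ (⨆ (j : ι) (_ : j ≠ i), W j) = ⊥

/-- `E` is a V-adapted trivializing subspace for `M`: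
`M = ⊕_{j ≥ 0} z^j·E` and `V_γ ∩ M = ⊕_{j ≥ 0} z^j·(V_{γ−j} ∩ E)` for every `γ`. -/
def IsVAdapted (z : N ≃ₗ[ℂ] N) (V : ℝ → Submodule ℂ N) (M E : Submodule ℂ N) : Prop :=
  E ≤ M ∧
  IsInternalDirectSum (fun j : ℕ => E.map ((z ^ (j : ℤ)).toLinearMap)) M ∧
  ∀ γ : ℝ, IsInternalDirectSum
    (fun j : ℕ => ((V (γ - j) ⊓ E).map ((z ^ (j : ℤ)).toLinearMap))) (V γ ⊓ M)

variable {N₁ N₂ : Type*}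
  [AddCommGroup N₁] [Module L N₁] [Module ℂ N₁] [IsScalarTower ℂ L N₁]
  [AddCommGroup N₂] [Module L N₂] [Module ℂ N₂] [IsScalarTower ℂ L N₂]

/-- The convolution filtration
`U_γ := Σ_{γ₁+γ₂=γ} (ℂ-span of {x₁ ⊗ x₂ : x₁ ∈ V¹_{γ₁}, x₂ ∈ V²_{γ₂}})` on
`N = N₁ ⊗_{ℂ[z,z⁻¹]} N₂`. -/
def conv (V₁ : ℝ → Submodule ℂ N₁) (V₂ : ℝ → Submodule ℂ N₂) (γ : ℝ) :
    Submodule ℂ (N₁ ⊗[L] N₂) :=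
  ⨆ (p : ℝ × ℝ) (_ : p.1 + p.2 = γ),
    Submodule.span ℂ {x : N₁ ⊗[L] N₂ | ∃ a ∈ V₁ p.1, ∃ b ∈ V₂ p.2, x = a ⊗ₜ[L] b}

section LatticeLemma

variable {R P ι κ : Type*} [Ring R] [AddCommGroup P] [Module R P]

/-- Intersecting a graded subspace with the sum of some of the graded pieces. -/
theorem iSup_inf_iSup_comp_of_iSupIndep {F G : ι → Submodule R P} (hF : iSupIndep F)
    (hGF : ∀ i, G i ≤ F i) (f : κ → ι) :
    (⨆ i, G i) ⊓ (⨆ k, F (f k)) = ⨆ k, G (f k) := by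
  have hle : (⨆ k, G (f k)) ≤ ⨆ k, F (f k) := iSup_mono fun k => hGF (f k)
  have hsplit : (⨆ i, G i) = (⨆ k, G (f k)) ⊔ ⨆ i ∈ (Set.range f)ᶜ, G i := by
    rw [iSup_split G (· ∈ Set.range f)]
    congr 1
    exact iSup_range
  have hdisj : (⨆ i ∈ (Set.range f)ᶜ, G i) ⊓ (⨆ k, F (f k)) = ⊥ := by
    rw [← iSup_range (g := F) (f := f), ← disjoint_iff]
    exact (hF.disjoint_biSup_biSup disjoint_compl_left).mono_left
      (iSup₂_mono fun i _ => hGF i)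
  rw [hsplit, sup_inf_assoc_of_le _ hle, hdisj, sup_bot_eq]

end LatticeLemma

theorem isInternalDirectSum_iff {P ι : Type*} [AddCommGroup P] [Module ℂ P]
    {W : ι → Submodule ℂ P} {S : Submodule ℂ P} :
    IsInternalDirectSum W S ↔ iSup W = S ∧ iSupIndep W := by
  simp only [IsInternalDirectSum, iSupIndep, disjoint_iff]

section Shift

variable (P : Type*) [AddCommGroup P] [Module L P] [Module ℂ P] [IsScalarTower ℂ L P]

/-- Multiplication by `z^k` as a `ℂ`-linear map. -/
abbrev shift (k : ℤ) : P →ₗ[ℂ] P := (zmul P ^ k).toLinearMap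

variable {P}

theorem zmul_zpow_apply (k : ℤ) (x : P) : (zmul P ^ k) x = (T k : L) • x := by
  induction k with
  | zero => simp
  | succ n ih =>
    rw [zpow_add_one, LinearEquiv.mul_apply, add_comm, T_add]
    rw [← (zmul P ^ (n : ℤ)).mul_apply, ← zpow_add_one, add_comm, zpow_add, zpow_one,
      LinearEquiv.mul_apply, ih, mul_smul]
    rfl
  | pred n ih =>
    rw [sub_eq_add_neg, add_comm, zpow_add, zpow_neg_one, LinearEquiv.mul_apply, ih, T_add,
      mul_smul]
    rfl

theorem shift_apply (k : ℤ) (x : P) : shift P k x = (T k : L) • x := zmul_zpow_apply k x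

theorem map_shift_map_shift (S : Submodule ℂ P) (j k : ℤ) :
    (S.map (shift P j)).map (shift P k) = S.map (shift P (k + j)) := by
  rw [← Submodule.map_comp]
  congr 1
  ext x
  simp only [LinearMap.comp_apply, shift_apply, T_add, mul_smul]

theorem map_shift_zero (S : Submodule ℂ P) : S.map (shift P 0) = S :=
  Submodule.map_id S

theorem iSupIndep_map_shift_int {E : Submodule ℂ P}
    (h : iSupIndep fun j : ℕ => E.map (shift P j)) :
    iSupIndep fun k : ℤ => E.map (shift P k) := by
  rw [iSupIndep_iff_supIndep]
  intro s
  rw [← iSupIndep_comp_coe_iff_supIndep]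
  obtain ⟨m, hm⟩ := s.bddBelow
  obtain ⟨n, hn⟩ : ∃ n : ℕ, ∀ k ∈ s, 0 ≤ k + n :=
    ⟨m.natAbs, fun k hk => by have := hm hk; omega⟩
  have hinj : Function.Injective fun k : s => ((k : ℤ) + n).toNat := by
    intro a b hab
    have ha := hn a a.2
    have hb := hn b b.2
    ext
    simp only at hab
    omega
  have := (h.comp hinj).map_orderIso (Submodule.orderIsoMapComap (zmul P ^ (-n : ℤ)))
  convert this using 1
  funext k
  have hk := hn k k.2
  change E.map (shift P k) =
    (E.map (shift P (((k : ℤ) + n).toNat : ℤ))).map (shift P (-n : ℤ))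
  rw [map_shift_map_shift, Int.toNat_of_nonneg hk]
  congr 2
  ring_nf

theorem exists_shift_mem_of_isFreeLattice {M : Submodule ℂ P} {r : ℕ}
    (hM : IsFreeLattice (zmul P) M r) (x : P) : ∃ n : ℕ, shift P n x ∈ M := by
  obtain ⟨hz, b, -, htop, hspan⟩ := hM
  have hstab : ∀ (m : ℕ) (y : P), y ∈ M → shift P m y ∈ M := by
    intro m y hy
    induction m with
    | zero => simpa using hy
    | succ m ih =>
      have := hz _ ih
      rw [shift_apply] at this ⊢
      rw [Nat.cast_succ, add_comm, T_add, mul_smul]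
      exact this
  have hadd : ∀ (m n : ℕ) (y : P), shift P n y ∈ M → shift P (m + n : ℕ) y ∈ M := by
    intro m n y hy
    have := hstab m _ hy
    rw [shift_apply, shift_apply, ← mul_smul, ← T_add] at this
    rw [shift_apply]
    exact_mod_cast this
  have hx : x ∈ Submodule.span ℂ (Set.range fun p : Fin r × ℤ => (zmul P ^ p.2) (b p.1)) := by
    rw [htop]; trivial
  induction hx using Submodule.span_induction with
  | mem y hy =>
    obtain ⟨⟨i, k⟩, rfl⟩ := hy
    refine ⟨k.natAbs, ?_⟩
    rw [← hspan]
    refine Submodule.subset_span ⟨(i, (k.natAbs + k).toNat), ?_⟩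
    have hk : 0 ≤ (k.natAbs : ℤ) + k := by omega
    simp only [zmul_zpow_apply, shift_apply, Int.toNat_of_nonneg hk, T_add, mul_smul]
  | zero => exact ⟨0, by simp⟩
  | add y w _ _ hy hw =>
    obtain ⟨m, hm⟩ := hy
    obtain ⟨n, hn⟩ := hw
    refine ⟨n + m, ?_⟩
    rw [map_add]
    exact add_mem (hadd n m y hm) (by rw [add_comm n m]; exact hadd m n w hn)
  | smul c y _ hy =>
    obtain ⟨m, hm⟩ := hy
    exact ⟨m, by rw [map_smul]; exact M.smul_mem c hm⟩

theorem IsVLattice.map_shift {V : ℝ → Submodule ℂ P} {A : Finset ℝ}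
    (hV : IsVLattice (zmul P) V A) (k : ℤ) (β : ℝ) : (V β).map (shift P k) = V (β + k) := by
  have h1 : ∀ β, (V β).map (shift P 1) = V (β + 1) := by
    intro β
    rw [← hV.map_z β]
    simp [shift]
  induction k with
  | zero => simp [map_shift_zero]
  | succ n ih =>
    rw [add_comm, ← map_shift_map_shift, ih, h1]
    push_cast
    ring_nf
  | pred n ih =>
    have := h1 (β + ((-n - 1 : ℤ) : ℝ))
    rw [show β + ((-n - 1 : ℤ) : ℝ) + 1 = β + ((-n : ℤ) : ℝ) by push_cast; ring, ← ih] at this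
    have h2 := congrArg (Submodule.map (shift P (-1))) this
    rw [map_shift_map_shift, map_shift_map_shift] at h2
    rw [show (-n - 1 : ℤ) = -1 + -n by ring, ← h2]
    simp [map_shift_zero, add_comm, sub_eq_add_neg]

variable {M E : Submodule ℂ P} {V : ℝ → Submodule ℂ P} {A : Finset ℝ} {r : ℕ}

theorem iSup_map_shift_eq_top (hM : IsFreeLattice (zmul P) M r)
    (hE : (⨆ j : ℕ, E.map (shift P j)) = M) : (⨆ k : ℤ, E.map (shift P k)) = ⊤ := by
  rw [eq_top_iff]
  intro x _
  obtain ⟨n, hn⟩ := exists_shift_mem_of_isFreeLattice hM x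
  have hx : x ∈ M.map (shift P (-n : ℤ)) :=
    ⟨_, hn, by rw [shift_apply, shift_apply, ← mul_smul, ← T_add]; simp⟩
  rw [← hE, Submodule.map_iSup] at hx
  refine SetLike.le_def.1 (iSup_le fun j => ?_) hx
  rw [map_shift_map_shift]
  exact le_iSup (fun k : ℤ => E.map (shift P k)) _

/-- A V-adapted subspace decomposes each `V_γ` over all integer powers of `z`. -/
theorem IsVAdapted.eq_iSup_map_shift (hM : IsFreeLattice (zmul P) M r)
    (hV : IsVLattice (zmul P) V A) (hE : IsVAdapted (zmul P) V M E) (γ : ℝ) :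
    V γ = ⨆ k : ℤ, (V (γ - k) ⊓ E).map (shift P k) := by
  apply le_antisymm
  · intro x hxV
    obtain ⟨n, hn⟩ := exists_shift_mem_of_isFreeLattice hM x
    have hn' : shift P n x ∈ V (γ + n) ⊓ M := by
      refine ⟨?_, hn⟩
      have := hV.map_shift n γ
      rw [Int.cast_natCast] at this
      rw [← this]
      exact Submodule.mem_map_of_mem hxV
    have hx : x ∈ (V (γ + n) ⊓ M).map (shift P (-n : ℤ)) :=
      ⟨_, hn', by rw [shift_apply, shift_apply, ← mul_smul, ← T_add]; simp⟩
    rw [← (hE.2.2 (γ + n)).1, Submodule.map_iSup] at hx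
    refine SetLike.le_def.1 (iSup_le fun j => ?_) hx
    rw [map_shift_map_shift]
    refine le_trans (le_of_eq ?_)
      (le_iSup (fun k : ℤ => (V (γ - k) ⊓ E).map (shift P k)) (-n + j))
    congr 3
    push_cast
    ring
  · refine iSup_le fun k => (Submodule.map_mono inf_le_left).trans ?_
    rw [hV.map_shift, sub_add_cancel]

theorem linearIndependent_laurent_of_iSupIndep {ι : Type*} (b : Module.Basis ι ℂ E)
    (hind : iSupIndep fun k : ℤ => E.map (shift P k)) :
    LinearIndependent L fun i => (b i : P) := by
  rw [linearIndependent_iff']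
  intro s g hg i hi
  classical
  set K : Finset ℤ := s.biUnion fun i => (g i).coeff.support
  have hexp : ∀ i ∈ s, g i = ∑ k ∈ K, (g i).coeff k • (T k : L) := by
    intro i hi
    ext a
    by_cases ha : a ∈ K
    · simp [AddMonoidAlgebra.coeff_sum, Finset.sum_apply', ha]
    · have : (g i).coeff a = 0 := by
        by_contra h0
        exact ha (Finset.mem_biUnion.2 ⟨i, hi, Finsupp.mem_support_iff.2 h0⟩)
      simp [AddMonoidAlgebra.coeff_sum, Finset.sum_apply', this]
  have hsum : ∑ k ∈ K, shift P k (∑ i ∈ s, (g i).coeff k • (b i : P)) = 0 := by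
    rw [← hg]
    simp only [map_sum, map_smul, shift_apply]
    rw [Finset.sum_comm]
    refine Finset.sum_congr rfl fun i hi => ?_
    conv_rhs => rw [hexp i hi, Finset.sum_smul]
    simp only [smul_assoc]
  have hzero := (iSupIndep_iff_finsetSum_eq_zero_imp_eq_zero _).1 hind K _
    (fun k _ => Submodule.mem_map_of_mem
      (sum_mem fun i _ => E.smul_mem _ (b i).2)) hsum
  ext k
  by_cases hk : k ∈ K
  · have h0 := (zmul P ^ k).map_eq_zero_iff.1 (hzero k hk)
    have h1 : ∑ i ∈ s, (g i).coeff k • b i = 0 := by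
      ext
      simpa using h0
    simpa using linearIndependent_iff'.1 b.linearIndependent s _ h1 i hi
  · by_contra h0
    exact hk (Finset.mem_biUnion.2 ⟨i, hi, Finsupp.mem_support_iff.2 h0⟩)

theorem top_le_span_laurent_of_iSup_eq_top {ι : Type*} (b : Module.Basis ι ℂ E)
    (htop : (⨆ k : ℤ, E.map (shift P k)) = ⊤) :
    ⊤ ≤ Submodule.span L (Set.range fun i => (b i : P)) := by
  intro x _
  have hx : x ∈ ⨆ k : ℤ, E.map (shift P k) := by rw [htop]; trivial
  suffices h : (⨆ k : ℤ, E.map (shift P k)) ≤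
      (Submodule.span L (Set.range fun i => (b i : P))).restrictScalars ℂ from h hx
  refine iSup_le fun k => ?_
  rintro _ ⟨e, he, rfl⟩
  rw [shift_apply]
  rw [Submodule.restrictScalars_mem]
  refine Submodule.smul_mem _ _ ?_
  have h1 := congrArg E.subtype (b.linearCombination_repr ⟨e, he⟩)
  rw [Finsupp.linearCombination_apply, map_finsuppSum] at h1
  change _ = e at h1
  rw [← h1, Finsupp.sum]
  refine Submodule.sum_mem _ fun i _ => ?_
  rw [map_smul, ← algebraMap_smul L (_ : ℂ) (E.subtype (b i))]
  exact Submodule.smul_mem _ _ (Submodule.subset_span ⟨i, rfl⟩)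

/-- A `ℂ`-basis of a subspace `E` with `P = ⊕_{k ∈ ℤ} z^k·E` is a `ℂ[z,z⁻¹]`-basis of `P`. -/
def laurentBasis {ι : Type*} (b : Module.Basis ι ℂ E)
    (hind : iSupIndep fun k : ℤ => E.map (shift P k))
    (htop : (⨆ k : ℤ, E.map (shift P k)) = ⊤) : Module.Basis ι L P :=
  Module.Basis.mk (linearIndependent_laurent_of_iSupIndep b hind)
    (top_le_span_laurent_of_iSup_eq_top b htop)

theorem laurentBasis_repr_mem {ι : Type*} (b : Module.Basis ι ℂ E)
    (hind : iSupIndep fun k : ℤ => E.map (shift P k))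
    (htop : (⨆ k : ℤ, E.map (shift P k)) = ⊤) (e : P) (he : e ∈ E) (i : ι) :
    (laurentBasis b hind htop).repr e i = C (b.repr ⟨e, he⟩ i) := by
  have h1 := congrArg E.subtype (b.linearCombination_repr ⟨e, he⟩)
  rw [Finsupp.linearCombination_apply, map_finsuppSum] at h1
  have h2 : e = (b.repr ⟨e, he⟩).sum fun j c => (C c : L) • laurentBasis b hind htop j := by
    refine h1.symm.trans (Finsupp.sum_congr fun j _ => ?_)
    rw [map_smul, C_eq_algebraMap, algebraMap_smul, laurentBasis, Module.Basis.mk_apply]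
    rfl
  conv_lhs => rw [h2]
  classical
  simp only [Finsupp.sum, map_sum, map_smul, Module.Basis.repr_self, Finsupp.coe_finsetSum,
    Finset.sum_apply, Finsupp.smul_apply, Finsupp.single_apply, smul_eq_mul, mul_ite, mul_one,
    mul_zero, Finset.sum_ite_eq', Finsupp.mem_support_iff]
  split_ifs with h
  · rfl
  · rw [not_not.1 h, map_zero]

end Shift

section Tensor

variable {P Q : Type*}
  [AddCommGroup P] [Module L P] [Module ℂ P] [IsScalarTower ℂ L P]
  [AddCommGroup Q] [Module L Q] [Module ℂ Q] [IsScalarTower ℂ L Q]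

variable (P Q) in
/-- The canonical `ℂ`-bilinear map to the tensor product over `ℂ[z,z⁻¹]`. -/
def tmulBilin : P →ₗ[ℂ] Q →ₗ[ℂ] P ⊗[L] Q :=
  LinearMap.mk₂ ℂ (fun a b => a ⊗ₜ[L] b) TensorProduct.add_tmul
    (fun _ _ _ => TensorProduct.smul_tmul' _ _ _) TensorProduct.tmul_add
    (fun _ _ _ => TensorProduct.tmul_smul _ _ _)

theorem tmulBilin_apply (a : P) (b : Q) : tmulBilin P Q a b = a ⊗ₜ[L] b := rfl

theorem span_tmul_eq_map₂ (S : Submodule ℂ P) (S' : Submodule ℂ Q) :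
    Submodule.span ℂ {x : P ⊗[L] Q | ∃ a ∈ S, ∃ b ∈ S', x = a ⊗ₜ[L] b} =
      Submodule.map₂ (tmulBilin P Q) S S' := by
  rw [Submodule.map₂_eq_span_image2]
  congr 1
  ext x
  simp only [Set.mem_ofPred_eq, Set.mem_image2, SetLike.mem_coe, tmulBilin_apply, eq_comm]

theorem map₂_map_shift (S : Submodule ℂ P) (S' : Submodule ℂ Q) (i j : ℤ) :
    Submodule.map₂ (tmulBilin P Q) (S.map (shift P i)) (S'.map (shift Q j)) =
      (Submodule.map₂ (tmulBilin P Q) S S').map (shift (P ⊗[L] Q) (i + j)) := by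
  rw [Submodule.map₂_map_map, Submodule.map_map₂]
  congr 1
  ext a b
  simp only [LinearMap.compl₁₂_apply, LinearMap.compr₂_apply, tmulBilin_apply, shift_apply,
    TensorProduct.smul_tmul_smul, T_add]

theorem iSupIndep_map_shift_map₂ {E : Submodule ℂ P} {E' : Submodule ℂ Q}
    (hind : iSupIndep fun k : ℤ => E.map (shift P k))
    (htop : (⨆ k : ℤ, E.map (shift P k)) = ⊤)
    (hind' : iSupIndep fun k : ℤ => E'.map (shift Q k))
    (htop' : (⨆ k : ℤ, E'.map (shift Q k)) = ⊤) :
    iSupIndep fun k : ℤ =>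
      (Submodule.map₂ (tmulBilin P Q) E E').map (shift (P ⊗[L] Q) k) := by
  set b := Module.Basis.ofVectorSpace ℂ E
  set b' := Module.Basis.ofVectorSpace ℂ E'
  set B := (laurentBasis b hind htop).tensorProduct (laurentBasis b' hind' htop') with hB
  have hcoeff : ∀ (k l : ℤ), l ≠ k → ∀ i,
      (Submodule.map₂ (tmulBilin P Q) E E').map (shift (P ⊗[L] Q) k) ≤
        LinearMap.ker (Finsupp.lapply l ∘ₗ (AddMonoidAlgebra.coeffLinearEquiv ℂ).toLinearMap ∘ₗ
          (B.coord i).restrictScalars ℂ) := by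
    rintro k l hlk ⟨i, j⟩
    rw [Submodule.map_le_iff_le_comap, Submodule.map₂_le]
    intro m hm n hn
    have h : B.repr ((T k : L) • (m ⊗ₜ[L] n)) (i, j) =
        C (b'.repr ⟨n, hn⟩ j * b.repr ⟨m, hm⟩ i) * T k := by
      rw [map_smul, Finsupp.smul_apply, hB, Module.Basis.tensorProduct_repr_tmul_apply,
        laurentBasis_repr_mem _ _ _ m hm, laurentBasis_repr_mem _ _ _ n hn, smul_eq_mul,
        smul_eq_mul, ← map_mul, mul_comm]
    rw [Submodule.mem_comap, LinearMap.mem_ker, tmulBilin_apply, shift_apply]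
    change (B.repr ((T k : L) • (m ⊗ₜ[L] n)) (i, j)).coeff l = 0
    rw [h, ← single_eq_C_mul_T, AddMonoidAlgebra.coeff_single, Finsupp.single_eq_of_ne hlk]
  intro k
  rw [disjoint_iff, eq_bot_iff]
  rintro x ⟨hx, hx'⟩
  rw [Submodule.mem_bot, ← B.repr.map_eq_zero_iff]
  ext i l
  by_cases hlk : l = k
  · exact SetLike.le_def.1 (iSup₂_le fun j hj => hcoeff j l (hlk ▸ hj.symm) i) hx'
  · exact hcoeff k l hlk i hx

/-- The sum of the images of the tensor products of the pieces induced on two given subspaces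
by a pair of filtrations, over all pairs of indices with sum `γ`. -/
def convOn (V : ℝ → Submodule ℂ P) (V' : ℝ → Submodule ℂ Q) (E : Submodule ℂ P)
    (E' : Submodule ℂ Q) (γ : ℝ) : Submodule ℂ (P ⊗[L] Q) :=
  ⨆ (p : ℝ × ℝ) (_ : p.1 + p.2 = γ),
    Submodule.map₂ (tmulBilin P Q) (V p.1 ⊓ E) (V' p.2 ⊓ E')

theorem convOn_le (V : ℝ → Submodule ℂ P) (V' : ℝ → Submodule ℂ Q) (E : Submodule ℂ P)
    (E' : Submodule ℂ Q) (γ : ℝ) :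
    convOn V V' E E' γ ≤ Submodule.map₂ (tmulBilin P Q) E E' :=
  iSup₂_le fun _ _ => Submodule.map₂_le_map₂ inf_le_right inf_le_right

variable {V : ℝ → Submodule ℂ P} {V' : ℝ → Submodule ℂ Q} {M E : Submodule ℂ P}
  {M' E' : Submodule ℂ Q} {A A' : Finset ℝ} {r r' : ℕ}

theorem conv_eq_iSup_map_shift
    (hM : IsFreeLattice (zmul P) M r) (hM' : IsFreeLattice (zmul Q) M' r')
    (hV : IsVLattice (zmul P) V A) (hV' : IsVLattice (zmul Q) V' A')
    (hE : IsVAdapted (zmul P) V M E) (hE' : IsVAdapted (zmul Q) V' M' E') (γ : ℝ) :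
    conv V V' γ =
      ⨆ k : ℤ, (convOn V V' E E' (γ - k)).map (shift (P ⊗[L] Q) k) := by
  simp only [conv, span_tmul_eq_map₂]
  apply le_antisymm
  · refine iSup₂_le fun p hp => ?_
    rw [hE.eq_iSup_map_shift hM hV p.1, hE'.eq_iSup_map_shift hM' hV' p.2,
      Submodule.map₂_iSup_left]
    refine iSup_le fun i => ?_
    rw [Submodule.map₂_iSup_right]
    refine iSup_le fun j => ?_
    rw [map₂_map_shift]
    refine le_iSup_of_le (i + j) (Submodule.map_mono ?_)
    refine le_iSup₂_of_le (p.1 - i, p.2 - j) ?_ le_rfl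
    rw [← hp]
    push_cast
    ring
  · refine iSup_le fun k => ?_
    simp only [convOn, Submodule.map_iSup]
    refine iSup₂_le fun q hq => ?_
    refine le_iSup₂_of_le (q.1 + k, q.2) (by simp only; linarith) ?_
    have h := map₂_map_shift (V q.1 ⊓ E) (V' q.2 ⊓ E') k 0
    rw [add_zero, map_shift_zero] at h
    rw [← h, ← hV.map_shift]
    exact Submodule.map₂_le_map₂ (Submodule.map_mono inf_le_left) inf_le_left

theorem map₂_eq_iSup_map_shift (hE : (⨆ j : ℕ, E.map (shift P j)) = M)
    (hE' : (⨆ j : ℕ, E'.map (shift Q j)) = M') :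
    (⨆ k : ℕ, (Submodule.map₂ (tmulBilin P Q) E E').map (shift (P ⊗[L] Q) k)) =
      Submodule.map₂ (tmulBilin P Q) M M' := by
  rw [← hE, ← hE']
  apply le_antisymm
  · refine iSup_le fun k => ?_
    have h := map₂_map_shift E E' k 0
    rw [add_zero] at h
    rw [← h]
    exact Submodule.map₂_le_map₂ (le_iSup (fun j : ℕ => E.map (shift P j)) k)
      (le_iSup (fun j : ℕ => E'.map (shift Q j)) 0)
  · rw [Submodule.map₂_iSup_left]
    refine iSup_le fun i => ?_
    rw [Submodule.map₂_iSup_right]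
    refine iSup_le fun j => ?_
    rw [map₂_map_shift, ← Nat.cast_add]
    exact le_iSup (fun k : ℕ =>
      (Submodule.map₂ (tmulBilin P Q) E E').map (shift (P ⊗[L] Q) k)) (i + j)

end Tensor

/-- Proposition 3.2.13: if `E₁, E₂` are V-adapted trivializing subspaces then the image
`E` of `E₁ ⊗_ℂ E₂` in `M = M₁ ⊗_{ℂ[z]} M₂` is a V-adapted trivializing subspace for
`(M, U)`, where `U` is the convolution filtration, and
`U_γ ∩ E = Σ_{γ₁+γ₂=γ} (image of (V¹_{γ₁} ∩ E₁) ⊗_ℂ (V²_{γ₂} ∩ E₂))`. -/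
theorem statement9
    (M₁ : Submodule ℂ N₁) (M₂ : Submodule ℂ N₂) (r₁ r₂ : ℕ)
    (V₁ : ℝ → Submodule ℂ N₁) (V₂ : ℝ → Submodule ℂ N₂) (A₁ A₂ : Finset ℝ)
    (hM₁ : IsFreeLattice (zmul N₁) M₁ r₁) (hM₂ : IsFreeLattice (zmul N₂) M₂ r₂)
    (hV₁ : IsVLattice (zmul N₁) V₁ A₁) (hV₂ : IsVLattice (zmul N₂) V₂ A₂)
    (E₁ : Submodule ℂ N₁) (E₂ : Submodule ℂ N₂)
    (hE₁ : IsVAdapted (zmul N₁) V₁ M₁ E₁) (hE₂ : IsVAdapted (zmul N₂) V₂ M₂ E₂) :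
    IsVAdapted (zmul (N₁ ⊗[L] N₂)) (conv V₁ V₂)
      (Submodule.span ℂ {x : N₁ ⊗[L] N₂ | ∃ a ∈ M₁, ∃ b ∈ M₂, x = a ⊗ₜ[L] b})
      (Submodule.span ℂ {x : N₁ ⊗[L] N₂ | ∃ a ∈ E₁, ∃ b ∈ E₂, x = a ⊗ₜ[L] b}) ∧
    ∀ γ : ℝ,
      conv V₁ V₂ γ ⊓
          Submodule.span ℂ {x : N₁ ⊗[L] N₂ | ∃ a ∈ E₁, ∃ b ∈ E₂, x = a ⊗ₜ[L] b} =
        ⨆ (p : ℝ × ℝ) (_ : p.1 + p.2 = γ),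
          Submodule.span ℂ
            {x : N₁ ⊗[L] N₂ | ∃ a ∈ V₁ p.1 ⊓ E₁, ∃ b ∈ V₂ p.2 ⊓ E₂, x = a ⊗ₜ[L] b} := by
  simp only [span_tmul_eq_map₂]
  obtain ⟨hE₁M, hsum₁, -⟩ := id hE₁
  obtain ⟨hE₂M, hsum₂, -⟩ := id hE₂
  rw [isInternalDirectSum_iff] at hsum₁ hsum₂
  set E := Submodule.map₂ (tmulBilin N₁ N₂) E₁ E₂
  have hind : iSupIndep fun k : ℤ => E.map (shift (N₁ ⊗[L] N₂) k) :=
    iSupIndep_map_shift_map₂ (iSupIndep_map_shift_int hsum₁.2)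
      (iSup_map_shift_eq_top hM₁ hsum₁.1) (iSupIndep_map_shift_int hsum₂.2)
      (iSup_map_shift_eq_top hM₂ hsum₂.1)
  have hindNat : iSupIndep fun k : ℕ => E.map (shift (N₁ ⊗[L] N₂) k) :=
    hind.comp Nat.cast_injective
  have hM := map₂_eq_iSup_map_shift hsum₁.1 hsum₂.1
  have hle : ∀ (γ : ℝ) (k : ℤ), (convOn V₁ V₂ E₁ E₂ (γ - k)).map (shift (N₁ ⊗[L] N₂) k) ≤
      E.map (shift (N₁ ⊗[L] N₂) k) :=
    fun γ k => Submodule.map_mono (convOn_le _ _ _ _ _)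
  have hconv := conv_eq_iSup_map_shift hM₁ hM₂ hV₁ hV₂ hE₁ hE₂
  have hinf : ∀ γ, conv V₁ V₂ γ ⊓ E = convOn V₁ V₂ E₁ E₂ γ := by
    intro γ
    have h := iSup_inf_iSup_comp_of_iSupIndep hind (hle γ) (fun _ : Unit => (0 : ℤ))
    simpa only [← hconv, ciSup_const, map_shift_zero, Int.cast_zero, sub_zero] using h
  refine ⟨⟨Submodule.map₂_le_map₂ hE₁M hE₂M, isInternalDirectSum_iff.2 ⟨hM, hindNat⟩,
    fun γ => isInternalDirectSum_iff.2 ⟨?_, ?_⟩⟩, hinf⟩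
  · have h := iSup_inf_iSup_comp_of_iSupIndep hind (hle γ) (fun k : ℕ => (k : ℤ))
    simp only [hinf]
    rw [← hM, hconv]
    exact_mod_cast h.symm
  · exact hindNat.mono fun k => Submodule.map_mono inf_le_right
end
end
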